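/- There is no uniquely C4+-saturated graph containing exactly four triangles. -/

import Mathlib

open SimpleGraph

/-- The diamond graph `C₄⁺`: a `4`-cycle with one chord, i.e. `K₄` minus an edge. -/
def diamond : SimpleGraph (Fin 4) := (⊤ : SimpleGraph (Fin 4)).deleteEdges {s(0, 1)}

/-- `G'` is a copy of `H` in `G`, i.e. a subgraph of `G` isomorphic to `H`. -/
def IsCopy {W V : Type*} (H : SimpleGraph W) {G : SimpleGraph V} (G' : G.Subgraph) : Prop :=
  Nonempty (G'.coe ≃g H)

/-- `G` is uniquely `H`-saturated: `G` is `H`-free, and adding any non-edge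
creates exactly one copy of `H`. -/
def UniquelySaturated {W V : Type*} (H : SimpleGraph W) (G : SimpleGraph V) : Prop :=
  (∀ G' : G.Subgraph, ¬ IsCopy H G') ∧
    ∀ u v : V, u ≠ v → ¬ G.Adj u v →
      ∃! G' : (G ⊔ SimpleGraph.fromEdgeSet {s(u, v)}).Subgraph, IsCopy H G'

theorem diam_sub {V : Type*} (H : SimpleGraph V) (p q r s : V) (hpq : H.Adj p q) (hpr : H.Adj p r)
    (hps : H.Adj p s) (hqr : H.Adj q r) (hqs : H.Adj q s) (hrs : r ≠ s) :
    ∃ G' : H.Subgraph, IsCopy diamond G' ∧ G'.verts = {p, q, r, s} := by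
  have h1 := hpq.ne
  have h2 := hpr.ne
  have h3 := hps.ne
  have h4 := hqr.ne
  have h5 := hqs.ne
  let f : Fin 4 → V := ![r, s, p, q]
  have hf : Function.Injective f := by
    intro a b hab
    fin_cases a <;> fin_cases b <;> simp [f] at hab ⊢ <;> grind
  let φ : diamond →g H := ⟨f, by
    intro a b hab
    fin_cases a <;> fin_cases b <;> simp [diamond] at hab <;> simp [f] <;>
      first | assumption | (apply SimpleGraph.Adj.symm; assumption)⟩
  let c : SimpleGraph.Copy diamond H := ⟨φ, hf⟩
  refine ⟨c.toSubgraph, ⟨c.isoToSubgraph.symm⟩, ?_⟩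
  ext v
  simp [SimpleGraph.Copy.toSubgraph, c, φ, f]
  grind

theorem diam_ex {V : Type*} (H : SimpleGraph V) (G' : H.Subgraph) (h : IsCopy diamond G') :
    ∃ p q r s, H.Adj p q ∧ H.Adj p r ∧ H.Adj p s ∧ H.Adj q r ∧ H.Adj q s ∧ r ≠ s := by
  obtain ⟨e⟩ := h
  have key : ∀ a b : Fin 4, diamond.Adj a b → H.Adj (e.symm a : V) (e.symm b : V) := by
    intro a b hab
    have := e.symm.map_rel_iff.mpr hab
    exact G'.adj_sub this
  refine ⟨e.symm 2, e.symm 3, e.symm 0, e.symm 1, key _ _ ?_, key _ _ ?_, key _ _ ?_, key _ _ ?_,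
    key _ _ ?_, ?_⟩
  iterate 5 simp [diamond]
  intro h
  have := e.symm.injective (Subtype.ext h)
  simp at this

def TE {V : Type*} (G : SimpleGraph V) (a b : V) : Prop := G.Adj a b ∧ ∃ c, G.Adj a c ∧ G.Adj b c
def NE {V : Type*} (G : SimpleGraph V) (a b : V) : Prop := G.Adj a b ∧ ∀ c, G.Adj a c → ¬ G.Adj b c

theorem TE.symm {V : Type*} {G : SimpleGraph V} {a b : V} (h : TE G a b) : TE G b a :=
  ⟨h.1.symm, h.2.imp fun _ h => ⟨h.2, h.1⟩⟩
theorem NE.symm {V : Type*} {G : SimpleGraph V} {a b : V} (h : NE G a b) : NE G b a :=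
  ⟨h.1.symm, fun c h1 h2 => h.2 c h2 h1⟩
theorem TN {V : Type*} {G : SimpleGraph V} {a b : V} (h : G.Adj a b) : TE G a b ∨ NE G a b := by
  unfold TE NE; grind
theorem TE.not {V : Type*} {G : SimpleGraph V} {a b : V} (h : TE G a b) : ¬ NE G a b := by
  unfold TE NE at *; grind

theorem free_of {V : Type*} {G : SimpleGraph V} (h : UniquelySaturated diamond G)
    {p q r s : V} (hpq : G.Adj p q) (hpr : G.Adj p r)
    (hps : G.Adj p s) (hqr : G.Adj q r) (hqs : G.Adj q s) : r = s := by
  by_contra hrs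
  obtain ⟨G', hG, _⟩ := diam_sub G p q r s hpq hpr hps hqr hqs hrs
  exact h.1 G' hG

theorem key {V : Type*} {G : SimpleGraph V} (h : UniquelySaturated diamond G)
    {u v : V} (huv : u ≠ v) (hn : ¬ G.Adj u v) :
    (∃ a b, a ≠ b ∧ NE G u a ∧ NE G u b ∧ NE G a v ∧ NE G b v ∧
      ∀ w, G.Adj u w → G.Adj w v → w = a ∨ w = b) ∨
    (∃ b, (TE G u b ∧ NE G b v ∨ NE G u b ∧ TE G b v) ∧
      ∀ w, G.Adj u w → G.Adj w v → w = b) := by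
  have hfree := @free_of V G h
  have hex := h.2 u v huv hn
  generalize hH : G ⊔ SimpleGraph.fromEdgeSet {s(u, v)} = H at hex
  obtain ⟨G0, hG0, huniq⟩ := hex
  simp only at hG0 huniq
  have hadj : ∀ a b, H.Adj a b ↔ G.Adj a b ∨ (a = u ∧ b = v) ∨ (a = v ∧ b = u) := by
    intro a b
    simp only [← hH, SimpleGraph.sup_adj, SimpleGraph.fromEdgeSet_adj, Set.mem_singleton_iff,
      Sym2.eq_iff]
    grind
  have hle : ∀ {a b}, G.Adj a b → H.Adj a b := fun h => (hadj _ _).2 (Or.inl h)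
  have huvH : H.Adj u v := (hadj _ _).2 (by simp)
  have hV : ∀ p q r s, H.Adj p q → H.Adj p r → H.Adj p s → H.Adj q r → H.Adj q s → r ≠ s →
      ∀ w, w ∈ G0.verts ↔ (w = p ∨ w = q ∨ w = r ∨ w = s) := by
    intro p q r s h1 h2 h3 h4 h5 h6 w
    obtain ⟨G', hG, hv⟩ := diam_sub H p q r s h1 h2 h3 h4 h5 h6
    rw [← huniq G' hG, hv]; simp
  -- two common neighbours
  have hA : ∀ a b, a ≠ b → G.Adj u a → G.Adj a v → G.Adj u b → G.Adj b v →
      ∀ w, w ∈ G0.verts ↔ (w = u ∨ w = v ∨ w = a ∨ w = b) := by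
    intro a b hab h1 h2 h3 h4
    exact hV u v a b huvH (hle h1) (hle h3) (hle h2.symm) (hle h4.symm) hab
  have hB : ∀ b d, G.Adj u b → G.Adj b v → G.Adj u d → G.Adj b d →
      ∀ w, w ∈ G0.verts ↔ (w = u ∨ w = b ∨ w = d ∨ w = v) := by
    intro b d h1 h2 h3 h4
    refine hV u b d v (hle h1) (hle h3) huvH (hle h4) (hle h2) ?_
    rintro rfl; exact hn h3
  have hC : ∀ b d, G.Adj u b → G.Adj b v → G.Adj v d → G.Adj b d →
      ∀ w, w ∈ G0.verts ↔ (w = v ∨ w = b ∨ w = d ∨ w = u) := by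
    intro b d h1 h2 h3 h4
    refine hV v b d u (hle h2.symm) (hle h3) huvH.symm (hle h4) (hle h1.symm) ?_
    rintro rfl; exact hn h3.symm
  have hE : (∃ a b, a ≠ b ∧ G.Adj u a ∧ G.Adj a v ∧ G.Adj u b ∧ G.Adj b v) ∨
      (∃ b, G.Adj u b ∧ G.Adj b v ∧ (TE G u b ∨ TE G b v)) := by
    obtain ⟨p, q, r, s, h1, h2, h3, h4, h5, h6⟩ := diam_ex H G0 hG0
    have hx := hfree (p := p) (q := q) (r := r) (s := s)
    rw [hadj] at h1 h2 h3 h4 h5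
    have hs := G.symm
    unfold TE
    have sy : ∀ a b, G.Adj a b → G.Adj b a := fun a b h => h.symm
    have irr : ∀ a, ¬ G.Adj a a := fun a => G.irrefl
    clear hV hA hB hC hfree huniq
    rcases h1 with h1 | ⟨rfl, rfl⟩ | ⟨rfl, rfl⟩
    · rcases h2 with h2 | ⟨rfl, rfl⟩ | ⟨rfl, rfl⟩ <;> grind
    · left; exact ⟨r, s, by grind⟩
    · left; exact ⟨r, s, by grind⟩
  have hN2 : ∀ a b, a ≠ b → G.Adj u a → G.Adj a v → G.Adj u b → G.Adj b v → 
      NE G u a ∧ NE G a v := by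
    intro a b hab h1 h2 h3 h4
    constructor
    · refine ⟨h1, fun c hc1 hc2 => ?_⟩
      have e1 := hA a b hab h1 h2 h3 h4 b
      have e2 := hB a c h1 h2 hc1 hc2 b
      have : b = c := by
        have := h3.ne; have := h4.ne; grind
      subst this
      exact huv (hfree hc2 h1.symm h2 h3.symm h4)
    · refine ⟨h2, fun c hc1 hc2 => ?_⟩
      have e1 := hA a b hab h1 h2 h3 h4 b
      have e2 := hC a c h1 h2 hc2 hc1 b
      have : b = c := by
        have := h3.ne; have := h4.ne; grind
      subst this
      exact huv (hfree hc1 h1.symm h2 h3.symm h4)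
  by_cases h2 : ∃ a b, a ≠ b ∧ G.Adj u a ∧ G.Adj a v ∧ G.Adj u b ∧ G.Adj b v
  · left
    obtain ⟨a, b, hab, h1, h2, h3, h4⟩ := h2
    have ha := hN2 a b hab h1 h2 h3 h4
    have hb := hN2 b a hab.symm h3 h4 h1 h2
    refine ⟨a, b, hab, ha.1, hb.1, ha.2, hb.2, ?_⟩
    intro w hw1 hw2
    by_contra hc
    have e1 := hA a b hab h1 h2 h3 h4 w
    have e2 := hA a w (by grind) h1 h2 hw1 hw2 w
    have := hw1.ne
    have := hw2.ne
    grind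
  · right
    obtain ⟨b, h1, h3, h4⟩ := hE.resolve_left h2
    have hu : ∀ w, G.Adj u w → G.Adj w v → w = b := by
      intro w hw1 hw2
      by_contra hc
      exact h2 ⟨w, b, hc, hw1, hw2, h1, h3⟩
    refine ⟨b, ?_, hu⟩
    rcases TN h1 with t1 | t1
    · rcases TN h3 with t2 | t2
      · exfalso
        obtain ⟨_, c, hc1, hc2⟩ := t1
        obtain ⟨_, d, hd1, hd2⟩ := t2
        have e1 := hB b c h1 h3 hc1 hc2 c
        have e2 := hC b d h1 h3 hd2 hd1 c
        have := hc1.ne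
        have := hc2.ne
        have hcv : c ≠ v := by rintro rfl; exact hn hc1
        have : c = d := by grind
        subst this
        exact huv (hfree hc2 h1.symm h3 hc1.symm hd2.symm)
      · exact Or.inl ⟨t1, t2⟩
    · rcases TN h3 with t2 | t2
      · exact Or.inr ⟨t1, t2⟩
      · exact absurd t1 (by
          rcases h4 with h4 | h4
          · exact h4.not
          · exact absurd t2 h4.not)

section
open scoped Classical
variable {V : Type*} [Fintype V] {G : SimpleGraph V}

noncomputable def ta (G : SimpleGraph V) (a b : V) : ℤ := if TE G a b then 1 else 0
noncomputable def nu (G : SimpleGraph V) (a b : V) : ℤ := if NE G a b then 1 else 0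
noncomputable def dg (G : SimpleGraph V) (a : V) : ℤ := ∑ w, nu G a w
noncomputable def tg (G : SimpleGraph V) (a : V) : ℤ := ∑ w, ta G a w
def inS (G : SimpleGraph V) (a : V) : Prop := ∃ b, TE G a b
noncomputable def sg (G : SimpleGraph V) (a : V) : ℤ := ∑ w, nu G a w * (if inS G w then 1 else 0)


theorem nu_symm (a b : V) : nu G a b = nu G b a := by
  unfold nu
  have : NE G a b ↔ NE G b a := ⟨NE.symm, NE.symm⟩
  simp [this]

theorem M_two (h : UniquelySaturated diamond G) {u v w : V} (h1 : NE G u w) (h2 : NE G u v)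
    (hwv : w ≠ v) : ∑ p, nu G w p * nu G p v = 2 := by
  have hn : ¬ G.Adj w v := fun hc => h1.2 v h2.1 hc
  rcases key h hwv hn with ⟨a, b, hab, ha, hb, ha', hb', hall⟩ | ⟨b, hb, hall⟩
  · rw [Fintype.sum_eq_add a b hab]
    · simp [nu, ha, hb, ha', hb']
    · intro x hx
      by_contra hc
      have : NE G w x ∧ NE G x v := by
        unfold nu at hc; by_contra h'; apply hc; grind
      have := hall x this.1.1 this.2.1
      grind
  · have := hall u h1.1.symm h2.1
    subst this
    rcases hb with hb | hb
    · exact absurd h1.symm hb.1.not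
    · exact absurd h2 hb.2.not

theorem deg_aux (h : UniquelySaturated diamond G) {u v : V} (h1 : NE G u v) :
    ∑ w, ∑ p, nu G u w * (nu G w p * nu G p v) = 2 * dg G u - 2 + dg G v := by
  have e : ∀ w, ∑ p, nu G u w * (nu G w p * nu G p v) =
      2 * nu G u w + (if w = v then dg G v - 2 else 0) := by
    intro w
    rw [← Finset.mul_sum]
    by_cases hw : NE G u w
    · by_cases hwv : w = v
      · subst hwv
        have : ∀ p, nu G w p * nu G p w = nu G w p := by
          intro p; rw [nu_symm p w]; unfold nu; split_ifs <;> simp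
        simp only [this]
        simp [nu, hw, dg]
      · rw [M_two h hw h1 hwv]; simp [nu, hw, hwv]
    · have : w ≠ v := by rintro rfl; exact hw h1
      simp [nu, hw, this]
  simp only [e, Finset.sum_add_distrib, ← Finset.mul_sum]
  simp [dg]; ring

theorem deg_eq (h : UniquelySaturated diamond G) {u v : V} (h1 : NE G u v) : dg G u = dg G v := by
  have e1 := deg_aux h h1
  have e2 := deg_aux h h1.symm
  rw [Finset.sum_comm] at e2
  have : ∑ w, ∑ p, nu G u w * (nu G w p * nu G p v) =
      ∑ w, ∑ p, nu G v p * (nu G p w * nu G w u) := by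
    refine Finset.sum_congr rfl fun w _ => Finset.sum_congr rfl fun p _ => ?_
    rw [nu_symm v p, nu_symm p w, nu_symm w u]; ring
  linarith


theorem tri (h : UniquelySaturated diamond G) {x y : V} (hxy : TE G x y) :
    ∃ z, y ≠ z ∧ TE G x z ∧ TE G y z ∧ ∀ w, TE G x w → w = y ∨ w = z := by
  obtain ⟨h1, z, h2, h3⟩ := id hxy
  refine ⟨z, h3.ne, ⟨h2, y, h1, h3.symm⟩, ⟨h3, x, h1.symm, h2.symm⟩, ?_⟩
  intro w hw
  by_contra hc
  push Not at hc
  by_cases ha : G.Adj w y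
  · exact hc.2 (free_of h h1 hw.1 h2 ha.symm h3)
  · rcases key h hc.1 ha with ⟨a, b, hab, ha, hb, ha', hb', hall⟩ | ⟨b, hb, hall⟩
    · rcases hall x hw.1.symm h1 with rfl | rfl
      · exact hxy.not ha'
      · exact hxy.not hb'
    · have := hall x hw.1.symm h1
      subst this
      rcases hb with hb | hb
      · exact hxy.not hb.2
      · exact hw.symm.not hb.1

theorem ta_sum (h : UniquelySaturated diamond G) {x y z : V} (hyz : y ≠ z) (hxy : TE G x y)
    (hxz : TE G x z) (f : V → ℤ) : ∑ w, ta G x w * f w = f y + f z := by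
  obtain ⟨z', h1, h2, h3, hall⟩ := tri h hxy
  have : z = z' := by have := hall z hxz; grind
  subst this
  rw [Fintype.sum_eq_add y z hyz]
  · simp [ta, hxy, hxz]
  · intro w hw
    have : ¬ TE G x w := fun hc => by have := hall w hc; grind
    simp [ta, this]

theorem tg_eq (h : UniquelySaturated diamond G) (x : V) : tg G x = if inS G x then 2 else 0 := by
  split_ifs with hS
  · obtain ⟨y, hy⟩ := hS
    obtain ⟨z, h1, h2, h3, hall⟩ := tri h hy
    have := ta_sum h h1 hy h2 (fun _ => 1)
    simpa [tg] using this
  · unfold tg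
    apply Finset.sum_eq_zero
    intro w _
    have : ¬ TE G x w := fun hc => hS ⟨w, hc⟩
    simp [ta, this]

theorem pointwise (h : UniquelySaturated diamond G) (x v : V) :
    ∑ w, (2 * (ta G x w * nu G w v) + 2 * (nu G x w * ta G w v) + nu G x w * nu G w v) =
    2 - 2 * ta G x v - 2 * nu G x v + (if v = x then dg G x - 2 else 0) := by
  by_cases hvx : v = x
  · subst hvx
    have e : ∀ w, (2 * (ta G v w * nu G w v) + 2 * (nu G v w * ta G w v) + nu G v w * nu G w v)
        = nu G v w := by
      intro w
      rw [nu_symm w v]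
      by_cases h1 : NE G v w
      · have : ¬ TE G v w := fun hc => hc.not h1
        have h3 : ¬ TE G w v := fun hc => hc.symm.not h1
        simp [ta, nu, h1, this, h3]
      · simp [nu, h1]
    have h1 : ¬ TE G v v := fun hc => G.irrefl hc.1
    have h2 : ¬ NE G v v := fun hc => G.irrefl hc.1
    simp only [e]
    simp [ta, nu, h1, h2, dg]
  · by_cases hadj : G.Adj x v
    · have : ∀ w, (2 * (ta G x w * nu G w v) + 2 * (nu G x w * ta G w v) + nu G x w * nu G w v)
          = 0 := by
        intro w
        by_cases hw : G.Adj x w ∧ G.Adj w v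
        · have h1 : ¬ NE G x w := fun hc => hc.2 v hadj hw.2
          have h2 : ¬ NE G w v := fun hc => hc.2 x hw.1.symm hadj.symm
          simp [nu, h1, h2]
        · have : (¬ TE G x w ∧ ¬ NE G x w) ∨ (¬ TE G w v ∧ ¬ NE G w v) := by
            unfold TE NE; grind
          rcases this with ⟨h1, h2⟩ | ⟨h1, h2⟩ <;> simp [ta, nu, h1, h2]
      simp only [this]
      rcases TN hadj with h1 | h1
      · have := h1.not
        simp [ta, nu, h1, this, hvx]
      · have : ¬ TE G x v := fun hc => hc.not h1
        simp [ta, nu, h1, this, hvx]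
    · have n1 : ¬ TE G x v := fun hc => hadj hc.1
      have n2 : ¬ NE G x v := fun hc => hadj hc.1
      have z : ∀ w, ¬ (G.Adj x w ∧ G.Adj w v) →
          (2 * (ta G x w * nu G w v) + 2 * (nu G x w * ta G w v) + nu G x w * nu G w v) = 0 := by
        intro w hw
        have : (¬ TE G x w ∧ ¬ NE G x w) ∨ (¬ TE G w v ∧ ¬ NE G w v) := by
          unfold TE NE; grind
        rcases this with ⟨h1, h2⟩ | ⟨h1, h2⟩ <;> simp [ta, nu, h1, h2]
      rcases key h (Ne.symm hvx) hadj with ⟨a, b, hab, ha, hb, ha', hb', hall⟩ | ⟨b, hb, hall⟩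
      · rw [Fintype.sum_eq_add a b hab]
        · have q1 : ¬ TE G x a := fun hc => hc.not ha
          have q2 : ¬ TE G x b := fun hc => hc.not hb
          have q3 : ¬ TE G a v := fun hc => hc.not ha'
          have q4 : ¬ TE G b v := fun hc => hc.not hb'
          simp [ta, nu, *]
        · intro w hw
          apply z
          intro hc
          have := hall w hc.1 hc.2
          grind
      · rw [Fintype.sum_eq_single b]
        · rcases hb with hb | hb
          · have q1 := hb.1.not
            have q2 : ¬ TE G b v := fun hc => hc.not hb.2
            simp [ta, nu, *]
          · have q1 := hb.2.not
            have q2 : ¬ TE G x b := fun hc => hc.not hb.1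
            simp [ta, nu, *]
        · intro w hw
          apply z
          intro hc
          exact hw (hall w hc.1 hc.2)

theorem count (h : UniquelySaturated diamond G) (x : V) :
    2 * (∑ w, ta G x w * dg G w) + 4 * sg G x + dg G x * dg G x =
    2 * Fintype.card V - 2 * tg G x - 2 * dg G x + dg G x - 2 := by
  have e : ∑ v, ∑ w, (2 * (ta G x w * nu G w v) + 2 * (nu G x w * ta G w v) +
      nu G x w * nu G w v) = _ := Finset.sum_congr rfl fun v _ => pointwise h x v
  rw [Finset.sum_comm] at e
  have e2 : ∀ w, ∑ v, (2 * (ta G x w * nu G w v) + 2 * (nu G x w * ta G w v) +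
      nu G x w * nu G w v) = 2 * (ta G x w * dg G w) +
        4 * (nu G x w * (if inS G w then 1 else 0)) + dg G x * nu G x w := by
    intro w
    simp only [Finset.sum_add_distrib, ← Finset.mul_sum]
    change 2 * (ta G x w * dg G w) + 2 * (nu G x w * tg G w) + nu G x w * dg G w = _
    have : nu G x w * dg G w = dg G x * nu G x w := by
      unfold nu
      split_ifs with hw
      · rw [deg_eq h hw]; ring
      · simp
    rw [this, tg_eq h]
    split_ifs <;> ring
  simp only [e2, Finset.sum_add_distrib, Finset.sum_sub_distrib, ← Finset.mul_sum] at e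
  rw [← dg, ← tg, ← sg] at e
  rw [e]
  simp
  ring

theorem sg_nonneg (x : V) : 0 ≤ sg G x := by
  unfold sg nu
  apply Finset.sum_nonneg
  intro w _
  split_ifs <;> simp

theorem dg_nonneg (x : V) : 0 ≤ dg G x := by
  unfold dg nu
  apply Finset.sum_nonneg
  intro w _
  split_ifs <;> simp

theorem sg_le_dg (x : V) : sg G x ≤ dg G x := by
  unfold sg dg nu
  apply Finset.sum_le_sum
  intro w _
  split_ifs <;> simp

theorem sg_eq_dg (x : V) (hx : ∀ w, NE G x w → inS G w) : sg G x = dg G x := by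
  unfold sg dg nu
  apply Finset.sum_congr rfl
  intro w _
  split_ifs with h1 h2
  · simp
  · exact absurd (hx w h1) h2
  · simp
  · simp

noncomputable def tr (G : SimpleGraph V) (x : V) : Finset V :=
  Finset.univ.filter (fun v => v = x ∨ TE G x v)

theorem tr_clique (h : UniquelySaturated diamond G) {x : V} (hx : inS G x) :
    tr G x ∈ G.cliqueSet 3 := by
  obtain ⟨y, hy⟩ := hx
  obtain ⟨z, h1, h2, h3, hall⟩ := tri h hy
  have : tr G x = {x, y, z} := by
    ext w
    simp only [tr, Finset.mem_filter, Finset.mem_univ, true_and, Finset.mem_insert,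
      Finset.mem_singleton]
    constructor
    · rintro (h | h)
      · exact Or.inl h
      · exact Or.inr (hall w h)
    · rintro (rfl | rfl | rfl) <;> simp [*]
  rw [this, SimpleGraph.mem_cliqueSet_iff, SimpleGraph.is3Clique_triple_iff]
  exact ⟨hy.1, h2.1, h3.1⟩

theorem clique_tr (h : UniquelySaturated diamond G) {x : V} {c : Finset V}
    (hc : c ∈ G.cliqueSet 3) (hx : x ∈ c) : c = tr G x := by
  have hc0 := hc
  rw [SimpleGraph.mem_cliqueSet_iff, SimpleGraph.is3Clique_iff] at hc
  have hT : ∀ w ∈ c, w ≠ x → TE G x w := by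
    obtain ⟨a, b, d, h1, h2, h3, rfl⟩ := hc
    intro w hw hwx
    have h1' := h1.symm
    have h2' := h2.symm
    have h3' := h3.symm
    simp only [Finset.mem_insert, Finset.mem_singleton] at hw hx
    unfold TE
    rcases hx with rfl | rfl | rfl <;> rcases hw with rfl | rfl | rfl <;>
      first | exact absurd rfl hwx | (refine ⟨by assumption, ?_⟩; grind)
  have hS : inS G x := by
    obtain ⟨a, b, d, h1, h2, h3, rfl⟩ := hc
    by_cases hax : a = x
    · exact ⟨b, hT b (by simp) (by rintro rfl; exact h1.ne hax)⟩
    · exact ⟨a, hT a (by simp) hax⟩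
  have hcl := tr_clique h hS
  rw [SimpleGraph.mem_cliqueSet_iff] at hc0 hcl
  apply Finset.eq_of_subset_of_card_le
  · intro w hw
    simp only [tr, Finset.mem_filter, Finset.mem_univ, true_and]
    by_cases hwx : w = x
    · exact Or.inl hwx
    · exact Or.inr (hT w hw hwx)
  · rw [hc0.card_eq, hcl.card_eq]

theorem sg_le_four (h : UniquelySaturated diamond G) (hcount : (G.cliqueSet 3).ncard = 4) (u : V) :
    sg G u ≤ 4 := by
  have e : sg G u = ((Finset.univ.filter fun w => NE G u w ∧ inS G w).card : ℤ) := by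
    rw [Finset.card_filter]
    unfold sg nu
    push_cast
    apply Finset.sum_congr rfl
    intro w _
    by_cases h1 : NE G u w <;> by_cases h2 : inS G w <;> simp [h1, h2]
  rw [e]
  suffices hh : (Finset.univ.filter fun w => NE G u w ∧ inS G w).card ≤ 4 by exact_mod_cast hh
  rw [← hcount, ← Set.ncard_coe_finset]
  apply Set.ncard_le_ncard_of_injOn (tr G)
  · intro w hw
    simp at hw
    exact tr_clique h hw.2
  · intro a ha b hb hab
    simp at ha hb
    by_contra hne
    have : b ∈ tr G a := by rw [hab]; simp [tr]
    simp only [tr, Finset.mem_filter, Finset.mem_univ, true_and] at this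
    rcases this with h1 | h1
    · exact hne h1.symm
    · exact ha.1.2 b hb.1.1 h1.1

theorem card_inS (h : UniquelySaturated diamond G) (hcount : (G.cliqueSet 3).ncard = 4) :
    (Finset.univ.filter fun x => inS G x).card = 12 := by
  have hf : (G.cliqueSet 3).Finite := Set.toFinite _
  rw [Set.ncard_eq_toFinset_card _ hf] at hcount
  rw [Finset.card_eq_sum_card_fiberwise (f := tr G) (t := hf.toFinset)]
  · rw [Finset.sum_congr rfl (g := fun _ => 3)]
    · rw [Finset.sum_const, hcount]; rfl
    · intro c hc
      rw [Set.Finite.mem_toFinset] at hc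
      have hcard := ((SimpleGraph.mem_cliqueSet_iff).1 hc).card_eq
      have : (Finset.univ.filter fun x => inS G x).filter (fun a => tr G a = c) = c := by
        ext a
        simp only [Finset.mem_filter, Finset.mem_univ, true_and]
        constructor
        · rintro ⟨_, rfl⟩; simp [tr]
        · intro ha
          have e := clique_tr h hc ha
          refine ⟨?_, e.symm⟩
          obtain ⟨b, hb, hba⟩ := Finset.exists_mem_ne (by omega : 1 < c.card) a
          rw [e] at hb
          simp only [tr, Finset.mem_filter, Finset.mem_univ, true_and] at hb
          exact ⟨b, hb.resolve_left hba⟩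
      rw [this]
      exact hcard
  · intro a ha
    simp only [Finset.coe_filter, Finset.mem_univ, true_and, Set.mem_ofPred_eq] at ha
    simp only [Set.Finite.coe_toFinset]
    exact tr_clique h ha

theorem card_ge (h : UniquelySaturated diamond G) (hcount : (G.cliqueSet 3).ncard = 4) :
    12 ≤ Fintype.card V := by
  rw [← card_inS h hcount]
  exact Finset.card_le_univ _

theorem card_twelve (h : UniquelySaturated diamond G) (hcount : (G.cliqueSet 3).ncard = 4)
    (hS : ∀ x, inS G x) : Fintype.card V = 12 := by
  rw [← card_inS h hcount]
  simp [hS]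

theorem countS (h : UniquelySaturated diamond G) {x y z : V} (hyz : y ≠ z) (hxy : TE G x y)
    (hxz : TE G x z) : 2 * (Fintype.card V : ℤ) =
      6 + dg G x + 2 * (dg G y + dg G z) + 4 * sg G x + dg G x * dg G x := by
  have e := count h x
  have hx : inS G x := ⟨y, hxy⟩
  rw [ta_sum h hyz hxy hxz, tg_eq h, if_pos hx] at e
  linarith

theorem countR (h : UniquelySaturated diamond G) {x : V} (hx : ¬ inS G x) :
    2 * (Fintype.card V : ℤ) = 2 + dg G x + 4 * sg G x + dg G x * dg G x := by
  have e := count h x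
  have : ∑ w, ta G x w * dg G w = 0 := by
    apply Finset.sum_eq_zero
    intro w _
    have : ¬ TE G x w := fun hc => hx ⟨w, hc⟩
    simp [ta, this]
  rw [this, tg_eq h, if_neg hx] at e
  linarith

theorem far (h : UniquelySaturated diamond G) {u v : V} (hu : ¬ inS G u) (hd : dg G v ≠ dg G u) :
    ∃ x, TE G v x ∧ dg G x = dg G u := by
  have huv : u ≠ v := by rintro rfl; exact hd rfl
  by_cases ha : G.Adj u v
  · rcases TN ha with t | t
    · exact absurd ⟨v, t⟩ hu
    · exact absurd (deg_eq h t).symm hd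
  · rcases key h huv ha with ⟨a, b, hab, ha, hb, ha', hb', hall⟩ | ⟨b, hb, hall⟩
    · exact absurd ((deg_eq h ha).trans (deg_eq h ha')).symm hd
    · rcases hb with hb | hb
      · exact absurd ⟨b, hb.1⟩ hu
      · exact ⟨b, hb.2.symm, (deg_eq h hb.1).symm⟩

theorem strict {p r : ℤ} (hp : 0 ≤ p) (hr : 0 ≤ r) (h : p * p + 3 * p = r * r + 3 * r) : p = r := by
  have : (p - r) * (p + r + 3) = 0 := by linarith
  rcases mul_eq_zero.1 this with h | h <;> omega

theorem arith {K p r s t : ℤ} (py : 0 ≤ p) (hp6 : p ≤ 6) (pu : 0 ≤ K) (hK : K ≤ 8)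
    (sk : s ≤ K) (s4 : s ≤ 4) (pt : 0 ≤ t) (hrel : K * K - K + 4 * t = p * p + 3 * p)
    (hz : r = K ∨ r = p) (hsu : 2 * s = 2 + p + r + 2 * t)
    (hn : 24 ≤ 2 + K + 4 * s + K * K) : False := by
  interval_cases p <;> interval_cases K <;> omega

theorem no_four (hcount : (G.cliqueSet 3).ncard = 4) (h : UniquelySaturated diamond G) : False := by
  by_cases hS : ∀ x, inS G x
  · have hn := card_twelve h hcount hS
    have hs : ∀ x, sg G x = dg G x := fun x => sg_eq_dg x fun w _ => hS w
    have : Nonempty V := Fintype.card_pos_iff.1 (by omega)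
    obtain ⟨x⟩ := this
    obtain ⟨y, hy⟩ := hS x
    obtain ⟨z, h1, h2, h3, -⟩ := tri h hy
    have ex := countS h h1 hy h2
    have ey := countS h h2.1.ne hy.symm h3
    have ez := countS h hy.1.ne h2.symm h3.symm
    rw [hn, hs] at ex ey ez
    push_cast at ex ey ez
    have px := dg_nonneg (G := G) x
    have py := dg_nonneg (G := G) y
    have pz := dg_nonneg (G := G) z
    have q1 := strict px py (by linarith)
    have q2 := strict px pz (by linarith)
    rw [← q1, ← q2] at ex
    have : dg G x ≤ 2 := by nlinarith
    generalize dg G x = d at *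
    interval_cases d <;> omega
  · push Not at hS
    obtain ⟨u, hu⟩ := hS
    have eu := countR h hu
    have s4 := sg_le_four h hcount u
    have sk := sg_le_dg (G := G) u
    have pu := dg_nonneg (G := G) u
    by_cases hall : ∀ y, dg G y = dg G u
    · have : (G.cliqueSet 3).Nonempty := by
        rw [Set.nonempty_iff_ne_empty]; intro hc; simp [hc] at hcount
      obtain ⟨c, hc⟩ := this
      rw [SimpleGraph.mem_cliqueSet_iff, SimpleGraph.is3Clique_iff] at hc
      obtain ⟨a, b, d, h1, h2, h3, -⟩ := hc
      have ea := countS h h3.ne ⟨h1, d, h2, h3⟩ ⟨h2, b, h1, h3.symm⟩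
      rw [hall a, hall b, hall d] at ea
      have := sg_nonneg (G := G) a
      linarith
    · push Not at hall
      obtain ⟨y, hy⟩ := hall
      obtain ⟨x, hyx, hx⟩ := far h hu hy
      obtain ⟨z, h1, h2, h3, -⟩ := tri h hyx
      have ey := countS h h1 hyx h2
      have ex := countS h h2.1.ne hyx.symm h3
      have ez := countS h hyx.1.ne h2.symm h3.symm
      have hs : ∀ v, dg G v ≠ dg G u → sg G v = dg G v := by
        intro v hv
        apply sg_eq_dg
        intro w hw
        have : dg G w ≠ dg G u := by rw [← deg_eq h hw]; exact hv
        obtain ⟨q, hq, _⟩ := far h hu this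
        exact ⟨q, hq⟩
      rw [hs y hy] at ey
      rw [hx] at ex ey ez
      have psx := sg_nonneg (G := G) x
      have py := dg_nonneg (G := G) y
      have pz := dg_nonneg (G := G) z
      have hp6 : dg G y ≤ 6 := by linarith
      have hrel : dg G u * dg G u - dg G u + 4 * sg G x = dg G y * dg G y + 3 * dg G y := by
        linarith
      have hn : 24 ≤ 2 + dg G u + 4 * sg G u + dg G u * dg G u := by
        rw [← eu]
        have := card_ge h hcount
        omega
      have hK : dg G u ≤ 8 := by nlinarith
      have hz : dg G z = dg G u ∨ dg G z = dg G y := by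
        by_cases hz : dg G z = dg G u
        · exact Or.inl hz
        · right
          rw [hs z hz] at ez
          exact strict pz py (by linarith)
      have hsu : 2 * sg G u = 2 + dg G y + dg G z + 2 * sg G x := by linarith
      exact arith py hp6 pu hK sk s4 psx hrel hz hsu hn
end

theorem stmt15 {V : Type*} [Fintype V] (G : SimpleGraph V)
    (hcount : (G.cliqueSet 3).ncard = 4) :
    ¬ UniquelySaturated diamond G := fun h => no_four hcount h
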